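/- Let n ≥ 1, c ∈ ℝ, and let f : H⁺ → Cl_n be smooth satisfying x_n Δf + c ∂f/∂x_n = c f/x_n on H⁺. Then w := Δf is smooth on H⁺ and satisfies x_n Δw + (c+2) ∂w/∂x_n = (c+2) w/x_n on H⁺. -/

import Mathlib

noncomputable section

open scoped symmDiff

/-- An explicit model of the real Clifford algebra `Cl_n` with generators `e 0, …, e (n-1)`
satisfying `eᵢ eⱼ + eⱼ eᵢ = -2 δᵢⱼ` (the Clifford algebra of the negative definite
quadratic form on `ℝⁿ`): elements are coordinate functions on the canonical basis
`(e_A)_{A ⊆ {0,…,n-1}}`, where `e_A` is the (increasingly ordered) product of the `e i`, `i ∈ A`. -/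
def Cl (n : ℕ) : Type := Finset (Fin n) → ℝ

namespace Cl

variable {n : ℕ}

instance : NormedAddCommGroup (Cl n) :=
  inferInstanceAs (NormedAddCommGroup (Finset (Fin n) → ℝ))

instance : NormedSpace ℝ (Cl n) :=
  inferInstanceAs (NormedSpace ℝ (Finset (Fin n) → ℝ))

/-- The coefficient of `a` at the basis element `e_A`. -/
def coeff (a : Cl n) (A : Finset (Fin n)) : ℝ := a A

/-- The sign occurring in the product `e_A * e_B = mulSign A B • e_{A ∆ B}`,
coming from the relations `eᵢ eⱼ = -eⱼ eᵢ` (i ≠ j) and `eᵢ² = -1`. -/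
def mulSign (A B : Finset (Fin n)) : ℝ :=
  (-1 : ℝ) ^ (((A ×ˢ B).filter fun p => p.2 < p.1).card + (A ∩ B).card)

/-- Clifford multiplication. -/
def mul (a b : Cl n) : Cl n := fun C =>
  ∑ A : Finset (Fin n), ∑ B : Finset (Fin n),
    if A ∆ B = C then mulSign A B * a A * b B else 0

/-- The unit `1` of the Clifford algebra. -/
def one : Cl n := Pi.single ∅ 1

/-- The embedding of the real scalars. -/
def scalar (r : ℝ) : Cl n := Pi.single ∅ r

/-- The generators `e i` (in the paper: `e_1, …, e_n`). -/
def e (i : Fin n) : Cl n := Pi.single {i} 1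

/-- Reversion: the anti-automorphism fixing all the `e i`. -/
def reverse (a : Cl n) : Cl n := fun A => (-1 : ℝ) ^ (A.card * (A.card - 1) / 2) * a A

/-- The main involution `′`: the automorphism with `(e i)′ = - e i`. -/
def involute (a : Cl n) : Cl n := fun A => (-1 : ℝ) ^ A.card * a A

/-- Clifford conjugation: the anti-automorphism with `conj (e i) = - e i`
(the composite of reversion and the main involution). -/
def conj (a : Cl n) : Cl n := fun A => (-1 : ℝ) ^ (A.card * (A.card + 1) / 2) * a A

/-- The norm on `Cl n`: the square root of the sum of the squares of the
coordinates in the standard basis. -/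
def norm (a : Cl n) : ℝ := Real.sqrt (∑ A : Finset (Fin n), a A ^ 2)

/-- Invertibility in the Clifford algebra. -/
def IsInvertible (a : Cl n) : Prop := ∃ b, mul a b = one ∧ mul b a = one

/-- The inverse of an invertible Clifford number (junk value `0` otherwise). -/
def inv (a : Cl n) : Cl n :=
  letI := Classical.propDecidable (IsInvertible a)
  if h : IsInvertible a then h.choose else 0

/-- The paravector `x₀ + x₁ e₁ + ⋯ + xₙ eₙ` attached to `x ∈ ℝ^{n+1}`. -/
def para (x : Fin (n + 1) → ℝ) : Cl n :=
  scalar (x 0) + ∑ i : Fin n, x i.succ • e i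

/-- Being a paravector. -/
def IsParavector (a : Cl n) : Prop := ∃ x : Fin (n + 1) → ℝ, a = para x

/-- The coordinates in `ℝ^{n+1}` of (the paravector part of) a Clifford number. -/
def paraCoord (a : Cl n) : Fin (n + 1) → ℝ :=
  Fin.cases (coeff a ∅) (fun i => coeff a {i})

/-- Being a (possibly empty) product of nonzero paravectors. -/
def IsProdOfParavectors (a : Cl n) : Prop :=
  ∃ l : List (Fin (n + 1) → ℝ), (∀ x ∈ l, x ≠ 0) ∧
    a = l.foldr (fun x b => mul (para x) b) one

/-- The special Ahlfors–Vahlen group `SAV(ℝ ⊕ ℝⁿ)`: 2×2 matrices `(a b; c d)` with entries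
in `Cl n` such that each entry is `0` or a product of nonzero paravectors,
`a ⬝ reverse d - b ⬝ reverse c = 1`, and `a c⁻¹, c⁻¹ d` are paravectors if `c ≠ 0`
resp. `b d⁻¹` is a paravector if `c = 0`. -/
structure SAV (n : ℕ) where
  a : Cl n
  b : Cl n
  c : Cl n
  d : Cl n
  prod_a : a = 0 ∨ IsProdOfParavectors a
  prod_b : b = 0 ∨ IsProdOfParavectors b
  prod_c : c = 0 ∨ IsProdOfParavectors c
  prod_d : d = 0 ∨ IsProdOfParavectors d
  det : mul a (reverse d) - mul b (reverse c) = one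
  cond_c : c ≠ 0 → IsParavector (mul a (inv c)) ∧ IsParavector (mul (inv c) d)
  cond_c0 : c = 0 → IsParavector (mul b (inv d))

/-- The Clifford number `c x + d` attached to a matrix `M` and `x ∈ ℝ^{n+1}`. -/
def cxd (M : SAV n) (x : Fin (n + 1) → ℝ) : Cl n := mul M.c (para x) + M.d

/-- The numerator `a x + b`. -/
def axb (M : SAV n) (x : Fin (n + 1) → ℝ) : Cl n := mul M.a (para x) + M.b

/-- The Möbius transformation `M<x> = (ax+b)(cx+d)⁻¹` as a Clifford number. -/
def moebiusCl (M : SAV n) (x : Fin (n + 1) → ℝ) : Cl n := mul (axb M x) (inv (cxd M x))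

/-- The Möbius transformation `M<x>` as a point of `ℝ^{n+1}`. -/
def moebius (M : SAV n) (x : Fin (n + 1) → ℝ) : Fin (n + 1) → ℝ :=
  paraCoord (moebiusCl M x)

/-- `a` lies in the subalgebra `Cl_{n-1}` generated by the `e j` with `j ≠ i`. -/
def memSub (a : Cl n) (i : Fin n) : Prop := ∀ A : Finset (Fin n), i ∈ A → coeff a A = 0

/-- The subgroup `SAV(ℝ ⊕ ℝ^{m})` of `SAV(ℝ ⊕ ℝ^{m+1})` of matrices whose entries lie
in the subalgebra `Cl_m ⊆ Cl_{m+1}`. -/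
structure SAVsub (m : ℕ) extends SAV (m + 1) where
  sub_a : memSub a (Fin.last m)
  sub_b : memSub b (Fin.last m)
  sub_c : memSub c (Fin.last m)
  sub_d : memSub d (Fin.last m)

/-- The `P`-part of `a ∈ Cl_{m+1} = Cl_m ⊕ Cl_m e_{top}`: `a = P a + (Q a) e_top`. -/
def Ppart {m : ℕ} (a : Cl (m + 1)) : Cl (m + 1) := fun A =>
  if Fin.last m ∈ A then 0 else a A

/-- The `Q`-part of `a ∈ Cl_{m+1} = Cl_m ⊕ Cl_m e_{top}`: `a = P a + (Q a) e_top`. -/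
def Qpart {m : ℕ} (a : Cl (m + 1)) : Cl (m + 1) := fun A =>
  if Fin.last m ∈ A then 0 else a (insert (Fin.last m) A)

/-- Partial derivative `∂f/∂xᵢ`. -/
def pderiv {E : Type*} [NormedAddCommGroup E] [NormedSpace ℝ E] {m : ℕ}
    (i : Fin m) (f : (Fin m → ℝ) → E) (x : Fin m → ℝ) : E :=
  fderiv ℝ f x (Pi.single i 1)

/-- The Euclidean Laplacian `Δ = Σᵢ ∂²/∂xᵢ²` (acting componentwise). -/
def lap {E : Type*} [NormedAddCommGroup E] [NormedSpace ℝ E] {m : ℕ}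
    (f : (Fin m → ℝ) → E) : (Fin m → ℝ) → E :=
  fun x => ∑ i : Fin m, pderiv i (pderiv i f) x

/-- The Euclidean Dirac operator `D f = ∂f/∂x₀ + Σᵢ eᵢ ∂f/∂xᵢ`. -/
def dirac (f : (Fin (n + 1) → ℝ) → Cl n) : (Fin (n + 1) → ℝ) → Cl n :=
  fun x => pderiv 0 f x + ∑ i : Fin n, mul (e i) (pderiv i.succ f x)

/-- Upper half-space `H⁺ = {x ∈ ℝ^{n+1} : xₙ > 0}`. -/
def upperHalf (n : ℕ) : Set (Fin (n + 1) → ℝ) := {x | 0 < x (Fin.last n)}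

/-- The Euclidean norm on `ℝ^m`. -/
def enorm {m : ℕ} (x : Fin m → ℝ) : ℝ := Real.sqrt (∑ i, x i ^ 2)

end Cl
namespace Cl

section Calculus

variable {E : Type*} [NormedAddCommGroup E] [NormedSpace ℝ E] {m : ℕ}
  {f g : (Fin m → ℝ) → E} {U : Set (Fin m → ℝ)} {x : Fin m → ℝ}

lemma pderiv_congr (hU : IsOpen U) (h : Set.EqOn f g U) (i : Fin m) :
    Set.EqOn (pderiv i f) (pderiv i g) U := fun x hx => by
  unfold pderiv
  rw [(h.eventuallyEq_of_mem (hU.mem_nhds hx)).fderiv_eq]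

lemma lap_congr (hU : IsOpen U) (h : Set.EqOn f g U) : Set.EqOn (lap f) (lap g) U :=
  fun _ hx => Finset.sum_congr rfl fun i _ => pderiv_congr hU (pderiv_congr hU h i) i hx

lemma contDiffOn_pderiv (hU : IsOpen U) (hf : ContDiffOn ℝ (⊤ : ℕ∞) f U) (i : Fin m) :
    ContDiffOn ℝ (⊤ : ℕ∞) (pderiv i f) U :=
  (hf.fderiv_of_isOpen hU (m := (⊤ : ℕ∞)) (by simp)).clm_apply contDiffOn_const

lemma contDiffOn_lap (hU : IsOpen U) (hf : ContDiffOn ℝ (⊤ : ℕ∞) f U) :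
    ContDiffOn ℝ (⊤ : ℕ∞) (lap f) U :=
  ContDiffOn.sum fun i _ => contDiffOn_pderiv hU (contDiffOn_pderiv hU hf i) i

lemma differentiableAt_of_contDiffOn (hU : IsOpen U) (hf : ContDiffOn ℝ (⊤ : ℕ∞) f U)
    (hx : x ∈ U) : DifferentiableAt ℝ f x :=
  (hf.contDiffAt (hU.mem_nhds hx)).differentiableAt (by simp)

lemma pderiv_add (hf : DifferentiableAt ℝ f x) (hg : DifferentiableAt ℝ g x) (i : Fin m) :
    pderiv i (fun y => f y + g y) x = pderiv i f x + pderiv i g x := by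
  simp [pderiv, fderiv_fun_add hf hg]

lemma pderiv_sum {ι : Type*} {s : Finset ι} {F : ι → (Fin m → ℝ) → E}
    (hF : ∀ j ∈ s, DifferentiableAt ℝ (F j) x) (i : Fin m) :
    pderiv i (fun y => ∑ j ∈ s, F j y) x = ∑ j ∈ s, pderiv i (F j) x := by
  simp [pderiv, fderiv_fun_sum hF]

lemma pderiv_const_smul (a : ℝ) (hf : DifferentiableAt ℝ f x) (i : Fin m) :
    pderiv i (fun y => a • f y) x = a • pderiv i f x := by
  simp [pderiv, fderiv_fun_const_smul hf]

lemma pderiv_coord_smul (hf : DifferentiableAt ℝ f x) (i k : Fin m) :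
    pderiv i (fun y => y k • f y) x =
      x k • pderiv i f x + (if i = k then (1 : ℝ) else 0) • f x := by
  have h := (ContinuousLinearMap.proj (R := ℝ) (φ := fun _ : Fin m => ℝ) k).hasFDerivAt (x := x)
  have h' := (h.fun_smul hf.hasFDerivAt).fderiv
  simp only [ContinuousLinearMap.proj_apply] at h'
  simp [pderiv, h', Pi.single_apply, eq_comm]

lemma pderiv_comm (hU : IsOpen U) (hf : ContDiffOn ℝ (⊤ : ℕ∞) f U) (hx : x ∈ U)
    (i j : Fin m) : pderiv i (pderiv j f) x = pderiv j (pderiv i f) x := by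
  have hd : DifferentiableAt ℝ (fderiv ℝ f) x :=
    ((hf.fderiv_of_isOpen hU (m := (⊤ : ℕ∞)) (by simp)).contDiffAt
      (hU.mem_nhds hx)).differentiableAt (by simp)
  have key (a b : Fin m) : pderiv a (pderiv b f) x =
      fderiv ℝ (fderiv ℝ f) x (Pi.single a 1) (Pi.single b 1) := by
    unfold pderiv
    rw [fderiv_clm_apply hd (differentiableAt_const _)]
    simp
  rw [key, key]
  refine ((hf.contDiffAt (hU.mem_nhds hx)).isSymmSndFDerivAt ?_).eq _ _
  simp only [minSmoothness_of_isRCLikeNormedField]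
  exact WithTop.coe_le_coe.mpr le_top

lemma pderiv_lap (hU : IsOpen U) (hf : ContDiffOn ℝ (⊤ : ℕ∞) f U) (hx : x ∈ U)
    (k : Fin m) : pderiv k (lap f) x = lap (pderiv k f) x := by
  have hsm (i : Fin m) := contDiffOn_pderiv hU hf i
  unfold lap
  rw [pderiv_sum fun i _ =>
    differentiableAt_of_contDiffOn hU (contDiffOn_pderiv hU (hsm i) i) hx]
  refine Finset.sum_congr rfl fun i _ => ?_
  rw [pderiv_comm hU (hsm i) hx]
  exact pderiv_congr hU (fun y hy => pderiv_comm hU hf hy k i) i hx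

lemma lap_const_smul (hU : IsOpen U) (hf : ContDiffOn ℝ (⊤ : ℕ∞) f U) (hx : x ∈ U)
    (a : ℝ) : lap (fun y => a • f y) x = a • lap f x := by
  unfold lap
  rw [Finset.smul_sum]
  refine Finset.sum_congr rfl fun i _ => ?_
  rw [← pderiv_const_smul a
    (differentiableAt_of_contDiffOn hU (contDiffOn_pderiv hU hf i) hx)]
  exact pderiv_congr hU
    (fun y hy => pderiv_const_smul a (differentiableAt_of_contDiffOn hU hf hy) i) i hx

lemma lap_coord_smul (hU : IsOpen U) (hf : ContDiffOn ℝ (⊤ : ℕ∞) f U) (hx : x ∈ U)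
    (k : Fin m) :
    lap (fun y => y k • f y) x = x k • lap f x + (2 : ℝ) • pderiv k f x := by
  have key (i : Fin m) : pderiv i (pderiv i fun y => y k • f y) x =
      x k • pderiv i (pderiv i f) x + if i = k then (2 : ℝ) • pderiv k f x else 0 := by
    have hsm := contDiffOn_pderiv hU hf i
    rw [pderiv_congr hU (fun y hy =>
      pderiv_coord_smul (differentiableAt_of_contDiffOn hU hf hy) i k) i hx]
    have hd := differentiableAt_of_contDiffOn hU hf hx
    have hd' := differentiableAt_of_contDiffOn hU hsm hx
    rw [pderiv_add (by fun_prop) (by fun_prop), pderiv_coord_smul hd', pderiv_const_smul _ hd]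
    split_ifs with h
    · subst h
      module
    · simp
  simp only [lap, key, Finset.sum_add_distrib, ← Finset.smul_sum]
  simp

end Calculus

lemma isOpen_upperHalf (n : ℕ) : IsOpen (upperHalf n) :=
  isOpen_lt continuous_const (continuous_apply _)

end Cl

/-- If `f` solves `xₙ Δf + c ∂f/∂xₙ = c f/xₙ` on `H⁺`, then `w = Δf` is smooth on `H⁺` and
solves the same equation with `c` replaced by `c + 2`. -/
theorem laplacian_shifts_weinstein_parameter
    (n : ℕ) (hn : 1 ≤ n) (c : ℝ)
    (f : (Fin (n + 1) → ℝ) → Cl n)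
    (hf : ContDiffOn ℝ (⊤ : ℕ∞) f (Cl.upperHalf n))
    (heq : ∀ x ∈ Cl.upperHalf n,
      x (Fin.last n) • Cl.lap f x + c • Cl.pderiv (Fin.last n) f x =
        (c / x (Fin.last n)) • f x) :
    ContDiffOn ℝ (⊤ : ℕ∞) (Cl.lap f) (Cl.upperHalf n) ∧
      ∀ x ∈ Cl.upperHalf n,
        x (Fin.last n) • Cl.lap (Cl.lap f) x +
            (c + 2) • Cl.pderiv (Fin.last n) (Cl.lap f) x =
          ((c + 2) / x (Fin.last n)) • Cl.lap f x := by
  have hU := Cl.isOpen_upperHalf n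
  refine ⟨Cl.contDiffOn_lap hU hf, ?_⟩
  have hne : ∀ x ∈ Cl.upperHalf n, x (Fin.last n) ≠ 0 := fun x hx => ne_of_gt hx
  set k := Fin.last n
  let g : (Fin (n + 1) → ℝ) → Cl n := fun x => (x k)⁻¹ • f x
  have hg : ContDiffOn ℝ (⊤ : ℕ∞) g (Cl.upperHalf n) :=
    ((contDiff_apply ℝ ℝ k).contDiffOn.inv hne).smul hf
  have hpg := Cl.contDiffOn_pderiv hU hg k
  have hfg : Set.EqOn f (fun x => x k • g x) (Cl.upperHalf n) := fun x hx => by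
    simp [g, smul_smul, mul_inv_cancel₀ (hne x hx)]
  have hlap : ∀ x ∈ Cl.upperHalf n,
      Cl.lap f x = x k • Cl.lap g x + (2 : ℝ) • Cl.pderiv k g x := fun x hx => by
    rw [Cl.lap_congr hU hfg hx, Cl.lap_coord_smul hU hg hx]
  have hpd : ∀ x ∈ Cl.upperHalf n, Cl.pderiv k f x = x k • Cl.pderiv k g x + g x :=
    fun x hx => by
      rw [Cl.pderiv_congr hU hfg k hx,
        Cl.pderiv_coord_smul (Cl.differentiableAt_of_contDiffOn hU hg hx)]
      simp
  have hgeq : ∀ x ∈ Cl.upperHalf n,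
      x k • Cl.lap g x + (c + 2) • Cl.pderiv k g x = 0 := fun x hx => by
    have h := heq x hx
    rw [hlap x hx, hpd x hx, hfg hx, smul_smul (c / x k), div_mul_cancel₀ c (hne x hx)] at h
    refine (smul_eq_zero.mp (?_ : x k • (x k • Cl.lap g x + (c + 2) • Cl.pderiv k g x) = 0)).resolve_left (hne x hx)
    linear_combination (norm := module) (1 : ℝ) • h
  have hw : Set.EqOn (Cl.lap f) (fun x => (-c) • Cl.pderiv k g x) (Cl.upperHalf n) :=
    fun x hx => by
      rw [hlap x hx]
      linear_combination (norm := module) (1 : ℝ) • hgeq x hx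
  intro x hx
  have hd := Cl.differentiableAt_of_contDiffOn hU hpg hx
  have hdl := Cl.differentiableAt_of_contDiffOn hU (Cl.contDiffOn_lap hU hg) hx
  have hdiff : Cl.pderiv k (fun y => y k • Cl.lap g y + (c + 2) • Cl.pderiv k g y) x = 0 := by
    rw [Cl.pderiv_congr (g := fun _ => 0) hU hgeq k hx]
    simp [Cl.pderiv]
  rw [Cl.pderiv_add (by fun_prop) (by fun_prop), Cl.pderiv_coord_smul hdl,
    Cl.pderiv_const_smul _ hd, Cl.pderiv_lap hU hg hx, if_pos rfl, one_smul] at hdiff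
  have hlg : Cl.lap g x = -((c + 2) / x k) • Cl.pderiv k g x := by
    refine smul_right_injective _ (hne x hx) ?_
    simp only [smul_smul, mul_neg, mul_div_cancel₀ _ (hne x hx)]
    rw [eq_neg_of_add_eq_zero_left (hgeq x hx), neg_smul]
  rw [Cl.lap_congr hU hw hx, Cl.lap_const_smul hU hpg hx, Cl.pderiv_congr hU hw k hx,
    Cl.pderiv_const_smul _ hd, hw hx]
  rw [hlg] at hdiff
  linear_combination (norm := module) (-c) • hdiff
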